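/- arXiv:2510.10355 — 4 statements merged into one kernel-verified Lean document; each statement's English description precedes it below -/
import Mathlib

section
/- Let E be a real inner product space, K ≥ 0, and f : E → ℝ with 0 ≤ f(y) ≤ K·‖y‖² for all y ∈ E. Suppose x ∈ E and g ∈ E satisfy the subgradient inequality f(y) ≥ f(x) + ⟨g, y − x⟩ for all y ∈ E. Then ‖g‖ ≤ 4K·‖x‖. -/
open RealInnerProductSpace

/-- Linear growth of subgradients of a function squeezed between `0` and
`K·‖·‖²`: if `0 ≤ f ≤ K‖·‖²` and `g` is a subgradient of `f` at `x`,
then `‖g‖ ≤ 4K‖x‖`. -/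
theorem subgradient_linear_growth
    {E : Type*} [NormedAddCommGroup E] [InnerProductSpace ℝ E]
    (K : ℝ) (hK : 0 ≤ K) (f : E → ℝ)
    (hf : ∀ y : E, 0 ≤ f y ∧ f y ≤ K * ‖y‖ ^ 2)
    (x g : E)
    (hg : ∀ y : E, f x + ⟪g, y - x⟫ ≤ f y) :
    ‖g‖ ≤ 4 * K * ‖x‖ := by
  rcases hK.eq_or_lt with rfl | hK
  · have h := hg (x + g)
    rw [add_sub_cancel_left, real_inner_self_eq_norm_sq] at h
    have hx := (hf x).1
    have hxg := (hf (x + g)).2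
    have hsq : ‖g‖ ^ 2 ≤ 0 := by linarith
    have hnorm : ‖g‖ = 0 := pow_eq_zero_iff two_ne_zero |>.mp (le_antisymm hsq (sq_nonneg _))
    simp [hnorm]
  · have h := (hg ((2 * K)⁻¹ • g)).trans (hf _).2
    rw [inner_sub_right, real_inner_smul_right, real_inner_self_eq_norm_sq, norm_smul,
      Real.norm_of_nonneg (by positivity)] at h
    have hx := (hf x).1
    have hinner := real_inner_le_norm g x
    have hquad : K * ((2 * K)⁻¹ * ‖g‖) ^ 2 = (4 * K)⁻¹ * ‖g‖ ^ 2 := by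
      field_simp
      ring
    have hlin : (2 * K)⁻¹ * ‖g‖ ^ 2 = 2 * ((4 * K)⁻¹ * ‖g‖ ^ 2) := by
      field_simp
      ring
    have hsq : ‖g‖ ^ 2 ≤ 4 * K * (‖g‖ * ‖x‖) :=
      (inv_mul_le_iff₀ (by positivity)).mp (by linarith)
    rcases (norm_nonneg g).eq_or_lt with hg0 | hg0
    · rw [← hg0]
      positivity
    · exact le_of_mul_le_mul_left (by linarith) hg0
end

section
/- Let Ω ⊆ ℝ³ be open, x ∈ Ω, τ > 0, let v : Ω → ℝ³ be differentiable at x, let ρ : Ω → ℝ be differentiable at x with ρ(y) > 0 for all y ∈ Ω, and let ρ₀ : Ω → ℝ with ρ₀(x) > 0. Assume the discrete continuity equation holds at x: (ρ(x) − ρ₀(x))/τ + ⟨v(x), ∇ρ(x)⟩ + ρ(x)·div v(x) = 0. Then the sparsity σ = 1/ρ (which is differentiable at x) satisfies the inequality (σ(x) − 1/ρ₀(x))/τ + ⟨v(x), ∇σ(x)⟩ ≤ (div v(x))·σ(x). -/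
open RealInnerProductSpace

/-- The gradient of the reciprocal of a real function is `-∇f / f²`. -/
theorem HasGradientAt.fun_inv {F : Type*} [NormedAddCommGroup F] [InnerProductSpace ℝ F]
    [CompleteSpace F] {f : F → ℝ} {g x : F} (hf : HasGradientAt f g x) (hx : f x ≠ 0) :
    HasGradientAt (fun y => (f y)⁻¹) (-(f x ^ 2)⁻¹ • g) x := by
  rw [hasGradientAt_iff_hasFDerivAt] at hf ⊢
  have h : InnerProductSpace.toDual ℝ F (-(f x ^ 2)⁻¹ • g) =
      -(f x ^ 2)⁻¹ • InnerProductSpace.toDual ℝ F g := by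
    ext y
    simp
  rw [h]
  exact (hasDerivAt_inv hx).comp_hasFDerivAt x hf

/-- The tangent line inequality for `r ↦ r⁻¹` at `a`. -/
theorem inv_sub_inv_le_neg_sub_div_sq {a b : ℝ} (ha : 0 < a) (hb : 0 < b) :
    a⁻¹ - b⁻¹ ≤ -(a - b) / a ^ 2 := by
  have h : -(a - b) / a ^ 2 - (a⁻¹ - b⁻¹) = (a - b) ^ 2 / (a ^ 2 * b) := by
    field_simp
    ring
  have : 0 ≤ (a - b) ^ 2 / (a ^ 2 * b) := by positivity
  linarith

/-- Pointwise inequality (ineq-for-sparsity) of the paper: the sparsity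
`σ = 1/ρ` satisfies `(σ − σ₀)/τ + v·∇σ ≤ (div v)·σ` whenever the discrete
continuity equation `(ρ − ρ₀)/τ + v·∇ρ + ρ div v = 0` holds. -/
theorem sparsity_inequality
    (Ω : Set (EuclideanSpace ℝ (Fin 3))) (hΩ : IsOpen Ω)
    (x : EuclideanSpace ℝ (Fin 3)) (hx : x ∈ Ω)
    (τ : ℝ) (hτ : 0 < τ)
    (v : EuclideanSpace ℝ (Fin 3) → EuclideanSpace ℝ (Fin 3))
    (Dv : EuclideanSpace ℝ (Fin 3) →L[ℝ] EuclideanSpace ℝ (Fin 3))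
    (hv : HasFDerivAt v Dv x)
    (ρ : EuclideanSpace ℝ (Fin 3) → ℝ) (gρ : EuclideanSpace ℝ (Fin 3))
    (hρ : HasGradientAt ρ gρ x)
    (hρ_pos : ∀ y ∈ Ω, 0 < ρ y)
    (ρ₀ : EuclideanSpace ℝ (Fin 3) → ℝ) (hρ₀ : 0 < ρ₀ x)
    (heq : (ρ x - ρ₀ x) / τ + ⟪v x, gρ⟫ +
        ρ x * LinearMap.trace ℝ (EuclideanSpace ℝ (Fin 3)) (Dv : _ →ₗ[ℝ] _) = 0) :
    ∃ gσ : EuclideanSpace ℝ (Fin 3),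
      HasGradientAt (fun y => (ρ y)⁻¹) gσ x ∧
      ((ρ x)⁻¹ - (ρ₀ x)⁻¹) / τ + ⟪v x, gσ⟫ ≤
        (LinearMap.trace ℝ (EuclideanSpace ℝ (Fin 3)) (Dv : _ →ₗ[ℝ] _)) * (ρ x)⁻¹ := by
  have ha : 0 < ρ x := hρ_pos x hx
  refine ⟨-(ρ x ^ 2)⁻¹ • gρ, hρ.fun_inv ha.ne', ?_⟩
  rw [inner_smul_right]
  set T := LinearMap.trace ℝ (EuclideanSpace ℝ (Fin 3)) (Dv : _ →ₗ[ℝ] _)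
  have hs : ⟪v x, gρ⟫ = -((ρ x - ρ₀ x) / τ) - ρ x * T := by linarith
  calc ((ρ x)⁻¹ - (ρ₀ x)⁻¹) / τ + -(ρ x ^ 2)⁻¹ * ⟪v x, gρ⟫
      ≤ -(ρ x - ρ₀ x) / ρ x ^ 2 / τ + -(ρ x ^ 2)⁻¹ * ⟪v x, gρ⟫ := by
        gcongr
        exact inv_sub_inv_le_neg_sub_div_sq ha hρ₀
    _ = T * (ρ x)⁻¹ := by
        rw [hs]
        field_simp
        ring
end

section
/- Let s ≥ 2 be a real number, ρ : ℝ³ → ℝ continuously differentiable, and v : ℝ³ → ℝ³ continuously differentiable with compact support. Then ∫_{ℝ³} (⟨v(x), ∇ρ(x)⟩ + ρ(x)·div v(x))·|ρ(x)|^{s−2}·ρ(x) dx = (1 − 1/s)·∫_{ℝ³} (div v(x))·|ρ(x)|^{s} dx. -/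
open MeasureTheory RealInnerProductSpace

noncomputable abbrev div3 (v : EuclideanSpace ℝ (Fin 3) → EuclideanSpace ℝ (Fin 3))
    (x : EuclideanSpace ℝ (Fin 3)) : ℝ :=
  LinearMap.trace ℝ (EuclideanSpace ℝ (Fin 3))
    (fderiv ℝ v x : EuclideanSpace ℝ (Fin 3) →ₗ[ℝ] EuclideanSpace ℝ (Fin 3))

section DivergenceTheorem

variable {E : Type*} [NormedAddCommGroup E] [InnerProductSpace ℝ E]

theorem HasCompactSupport.trace_fderiv {v : E → E} (hv : HasCompactSupport v) :
    HasCompactSupport fun x => LinearMap.trace ℝ E (fderiv ℝ v x : E →ₗ[ℝ] E) :=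
  (hv.fderiv ℝ).comp_left (g := fun T : E →L[ℝ] E => LinearMap.trace ℝ E (T : E →ₗ[ℝ] E))
    (by simp)

variable [FiniteDimensional ℝ E]

theorem continuous_trace_fderiv {v : E → E} (hv : ContDiff ℝ 1 v) :
    Continuous fun x => LinearMap.trace ℝ E (fderiv ℝ v x : E →ₗ[ℝ] E) := by
  have hv' : Continuous (fderiv ℝ v) := hv.continuous_fderiv one_ne_zero
  simp only [LinearMap.trace_eq_sum_inner _ (stdOrthonormalBasis ℝ E),
    ContinuousLinearMap.coe_coe]
  fun_prop

variable [MeasurableSpace E] [BorelSpace E]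

/-- Integration by parts for the divergence (the trace of the derivative) of a compactly
supported vector field. -/
theorem integral_mul_trace_fderiv_eq_neg_integral_fderiv_apply
    (μ : Measure E) [μ.IsAddHaarMeasure] {f : E → ℝ} {v : E → E}
    (hf : ContDiff ℝ 1 f) (hv : ContDiff ℝ 1 v) (hv_supp : HasCompactSupport v) :
    ∫ x, f x * LinearMap.trace ℝ E (fderiv ℝ v x : E →ₗ[ℝ] E) ∂μ =
      -∫ x, fderiv ℝ f x (v x) ∂μ := by
  let b := stdOrthonormalBasis ℝ E
  have hf' : Continuous (fderiv ℝ f) := hf.continuous_fderiv one_ne_zero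
  have hfc : Continuous f := hf.continuous
  have hcoord (i) : ContDiff ℝ 1 fun x => inner ℝ (b i) (v x) := contDiff_const.inner ℝ hv
  have hcoord_supp (i) : HasCompactSupport fun x => inner ℝ (b i) (v x) :=
    hv_supp.comp_left (g := fun y => inner ℝ (b i) y) (inner_zero_right _)
  have hcoordc (i) := (hcoord i).continuous
  have hcoord' (i) := (hcoord i).continuous_fderiv one_ne_zero
  have int_left (i) : Integrable (fun x => fderiv ℝ f x (b i) * inner ℝ (b i) (v x)) μ :=
    Continuous.integrable_of_hasCompactSupport (by fun_prop) (hcoord_supp i).mul_left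
  have int_right (i) :
      Integrable (fun x => f x * fderiv ℝ (fun x => inner ℝ (b i) (v x)) x (b i)) μ :=
    Continuous.integrable_of_hasCompactSupport
      (hfc.mul ((hcoord' i).clm_apply continuous_const))
      ((hcoord_supp i).fderiv_apply ℝ (b i)).mul_left
  have int_mul (i) : Integrable (fun x => f x * inner ℝ (b i) (v x)) μ :=
    Continuous.integrable_of_hasCompactSupport (by fun_prop) (hcoord_supp i).mul_left
  have trace_eq (x) : LinearMap.trace ℝ E (fderiv ℝ v x : E →ₗ[ℝ] E) =
      ∑ i, fderiv ℝ (fun x => inner ℝ (b i) (v x)) x (b i) := by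
    rw [LinearMap.trace_eq_sum_inner _ b]
    refine Finset.sum_congr rfl fun i _ => ?_
    rw [fderiv_inner_apply ℝ (differentiableAt_const _) (hv.differentiable one_ne_zero x)]
    simp
  have fderiv_eq (x) : fderiv ℝ f x (v x) = ∑ i, fderiv ℝ f x (b i) * inner ℝ (b i) (v x) := by
    conv_lhs => rw [← b.sum_repr' (v x)]
    simp [mul_comm]
  simp_rw [trace_eq, fderiv_eq, Finset.mul_sum]
  rw [integral_finsetSum _ fun i _ => int_right i, integral_finsetSum _ fun i _ => int_left i,
    ← Finset.sum_neg_distrib]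
  exact Finset.sum_congr rfl fun i _ =>
    integral_mul_fderiv_eq_neg_fderiv_mul_of_integrable (int_left i) (int_right i) (int_mul i)
      (fun x _ => hf.differentiable one_ne_zero x)
      (fun x _ => (hcoord i).differentiable one_ne_zero x)

end DivergenceTheorem

/-- Transport identity (transport-rho) of the paper:
`∫ div(ρv)·|ρ|^{s−2}ρ dx = (1 − 1/s)·∫ (div v)·|ρ|^s dx`. -/
theorem transport_identity_density
    (s : ℝ) (hs : 2 ≤ s)
    (ρ : EuclideanSpace ℝ (Fin 3) → ℝ) (hρ : ContDiff ℝ 1 ρ)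
    (v : EuclideanSpace ℝ (Fin 3) → EuclideanSpace ℝ (Fin 3))
    (hv : ContDiff ℝ 1 v) (hv_supp : HasCompactSupport v) :
    ∫ x, (⟪v x, gradient ρ x⟫ + ρ x * div3 v x) * |ρ x| ^ (s - 2) * ρ x =
      (1 - 1 / s) * ∫ x, div3 v x * |ρ x| ^ s := by
  have hs1 : 1 < s := by linarith
  have hs0 : s ≠ 0 := by linarith
  have hf : ContDiff ℝ 1 fun x => |ρ x| ^ s := by
    simpa only [Real.norm_eq_abs] using hρ.norm_rpow hs1
  have fderiv_eq (x) : fderiv ℝ (fun x => |ρ x| ^ s) x (v x) =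
      s * |ρ x| ^ (s - 2) * ρ x * fderiv ℝ ρ x (v x) := by
    have h := (hasDerivAt_abs_rpow (ρ x) hs1).comp_hasFDerivAt x
      (hρ.differentiable one_ne_zero x).hasFDerivAt
    simpa [Function.comp_def] using congrArg (fun L => L (v x)) h.fderiv
  have pow_eq (x) : |ρ x| ^ (s - 2) * ρ x * ρ x = |ρ x| ^ s := by
    rw [mul_assoc, ← abs_mul_abs_self, ← sq, ← Real.rpow_natCast,
      ← Real.rpow_add_of_nonneg (abs_nonneg _) (by linarith) (by norm_num)]
    norm_num
  have integrand_eq (x) : (⟪v x, gradient ρ x⟫ + ρ x * div3 v x) * |ρ x| ^ (s - 2) * ρ x =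
      1 / s * fderiv ℝ (fun x => |ρ x| ^ s) x (v x) + |ρ x| ^ s * div3 v x := by
    rw [real_inner_comm, inner_gradient_left, fderiv_eq, ← pow_eq]
    field_simp
  have int_fderiv : Integrable fun x => fderiv ℝ (fun x => |ρ x| ^ s) x (v x) :=
    ((hf.continuous_fderiv one_ne_zero).clm_apply hv.continuous).integrable_of_hasCompactSupport
      (hv_supp.mono fun x hx hvx => hx (by simp [hvx]))
  have int_div : Integrable fun x => |ρ x| ^ s * div3 v x :=
    (hf.continuous.mul (continuous_trace_fderiv hv)).integrable_of_hasCompactSupport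
      hv_supp.trace_fderiv.mul_left
  have parts := integral_mul_trace_fderiv_eq_neg_integral_fderiv_apply volume hf hv hv_supp
  simp_rw [integrand_eq, mul_comm (div3 v _)]
  rw [integral_add (int_fderiv.const_mul _) int_div, integral_const_mul, parts]
  ring
end

section
/- Let r ≥ 2 be a real number, ρ : ℝ³ → ℝ twice continuously differentiable, and v : ℝ³ → ℝ³ continuously differentiable with compact support. Then ∫_{ℝ³} ⟨∇(x ↦ ⟨v(x), ∇ρ(x)⟩)(x), |∇ρ(x)|^{r−2}·∇ρ(x)⟩ dx = ∫_{ℝ³} (|∇ρ(x)|^{r−2}·⟨∇ρ(x), Dv(x)·∇ρ(x)⟩ − (1/r)·(div v(x))·|∇ρ(x)|^{r}) dx. -/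
open MeasureTheory RealInnerProductSpace

section InnerProductCalculus

variable {E : Type*} [NormedAddCommGroup E] [InnerProductSpace ℝ E]

/-- Integration by parts for a scalar function against a compactly supported vector field. -/
theorem integral_fderiv_apply_eq_neg_integral_trace_mul [FiniteDimensional ℝ E]
    [MeasurableSpace E] [BorelSpace E] {μ : Measure E} [μ.IsAddHaarMeasure]
    {h : E → ℝ} {v : E → E} (hh : ContDiff ℝ 1 h) (hv : ContDiff ℝ 1 v)
    (hv_supp : HasCompactSupport v) :
    ∫ x, fderiv ℝ h x (v x) ∂μ =
      -∫ x, LinearMap.trace ℝ E (fderiv ℝ v x : E →ₗ[ℝ] E) * h x ∂μ := by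
  let b := stdOrthonormalBasis ℝ E
  have hg (i) : ContDiff ℝ 1 fun x => ⟪b i, v x⟫ := contDiff_const.inner ℝ hv
  have hg_supp (i) : HasCompactSupport fun x => ⟪b i, v x⟫ :=
    hv_supp.comp_left (g := fun y => ⟪b i, y⟫) (inner_zero_right _)
  have hg_fderiv (i) (x : E) : fderiv ℝ (fun x => ⟪b i, v x⟫) x (b i) =
      ⟪b i, fderiv ℝ v x (b i)⟫ := by
    rw [fderiv_inner_apply ℝ (differentiableAt_const _) (hv.differentiable one_ne_zero x)]
    simp
  have hi₁ (i) : Integrable (fun x => fderiv ℝ h x (b i) * ⟪b i, v x⟫) μ :=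
    (((hh.continuous_fderiv one_ne_zero).clm_apply continuous_const).mul
      (hg i).continuous).integrable_of_hasCompactSupport (hg_supp i).mul_left
  have hi₂ (i) : Integrable (fun x => h x * fderiv ℝ (fun x => ⟪b i, v x⟫) x (b i)) μ :=
    (hh.continuous.mul (((hg i).continuous_fderiv one_ne_zero).clm_apply
      continuous_const)).integrable_of_hasCompactSupport
      ((hg_supp i).fderiv_apply (𝕜 := ℝ) (b i)).mul_left
  have hi₃ (i) : Integrable (fun x => h x * ⟪b i, v x⟫) μ :=
    (hh.continuous.mul (hg i).continuous).integrable_of_hasCompactSupport (hg_supp i).mul_left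
  have hparts (i) := integral_mul_fderiv_eq_neg_fderiv_mul_of_integrable (hi₁ i) (hi₂ i) (hi₃ i)
    (fun x _ => hh.differentiable one_ne_zero x)
    (fun x _ => (hg i).differentiable one_ne_zero x)
  have hleft (x : E) : fderiv ℝ h x (v x) = ∑ i, fderiv ℝ h x (b i) * ⟪b i, v x⟫ := by
    conv_lhs => rw [← b.sum_repr' (v x)]
    simp [mul_comm]
  have hright (x : E) : LinearMap.trace ℝ E (fderiv ℝ v x : E →ₗ[ℝ] E) * h x =
      ∑ i, h x * fderiv ℝ (fun x => ⟪b i, v x⟫) x (b i) := by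
    simp_rw [hg_fderiv]
    rw [LinearMap.trace_eq_sum_inner _ b, Finset.sum_mul]
    simp [mul_comm]
  simp_rw [hleft, hright]
  rw [integral_finsetSum _ fun i _ => hi₁ i, integral_finsetSum _ fun i _ => hi₂ i,
    ← Finset.sum_neg_distrib]
  exact Finset.sum_congr rfl fun i _ => by rw [hparts i, neg_neg]

variable [CompleteSpace E]

theorem ContDiff.gradient {f : E → ℝ} (hf : ContDiff ℝ 2 f) : ContDiff ℝ 1 (gradient f) :=
  (InnerProductSpace.toDual ℝ E).symm.contDiff.comp
    (hf.fderiv_right (m := 1) (by norm_num [one_add_one_eq_two]))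

theorem inner_fderiv_gradient_left {f : E → ℝ} (hf : ContDiff ℝ 2 f) (x u w : E) :
    ⟪fderiv ℝ (gradient f) x u, w⟫ = fderiv ℝ (fderiv ℝ f) x u w := by
  have hd' : DifferentiableAt ℝ (fderiv ℝ f) x :=
    (hf.fderiv_right (m := 1) (by norm_num [one_add_one_eq_two])).differentiable one_ne_zero x
  have h := fderiv_inner_apply ℝ (hf.gradient.differentiable one_ne_zero x)
    (differentiableAt_const w) u
  simp_rw [inner_gradient_left] at h
  rw [fderiv_clm_apply hd' (differentiableAt_const w)] at h
  simpa using h.symm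

/-- The Hessian, viewed as the derivative of the gradient, is symmetric. -/
theorem inner_fderiv_gradient_comm {f : E → ℝ} (hf : ContDiff ℝ 2 f) (x u w : E) :
    ⟪fderiv ℝ (gradient f) x u, w⟫ = ⟪u, fderiv ℝ (gradient f) x w⟫ := by
  rw [real_inner_comm _ u, inner_fderiv_gradient_left hf, inner_fderiv_gradient_left hf]
  exact hf.contDiffAt.isSymmSndFDerivAt (by simp) u w

end InnerProductCalculus

/-- Calculus identity (calulus-nonlin-rho-r) of the paper, used for the
`W^{1,r}` estimates of the mass density:
`∫ ⟨∇(v·∇ρ), |∇ρ|^{r−2}∇ρ⟩ dx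
  = ∫ (|∇ρ|^{r−2}·⟨∇ρ, Dv·∇ρ⟩ − (1/r)·(div v)·|∇ρ|^r) dx`. -/
theorem calculus_identity_gradient_density
    (r : ℝ) (hr : 2 ≤ r)
    (ρ : EuclideanSpace ℝ (Fin 3) → ℝ) (hρ : ContDiff ℝ 2 ρ)
    (v : EuclideanSpace ℝ (Fin 3) → EuclideanSpace ℝ (Fin 3))
    (hv : ContDiff ℝ 1 v) (hv_supp : HasCompactSupport v) :
    ∫ x, ⟪gradient (fun y => ⟪v y, gradient ρ y⟫) x,
          ‖gradient ρ x‖ ^ (r - 2) • gradient ρ x⟫ =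
      ∫ x, (‖gradient ρ x‖ ^ (r - 2) *
              ⟪gradient ρ x, fderiv ℝ v x (gradient ρ x)⟫
            - (1 / r) * div3 v x * ‖gradient ρ x‖ ^ r) := by
  set G := gradient ρ with hG_def
  have hG : ContDiff ℝ 1 G := hρ.gradient
  have hh : ContDiff ℝ 1 fun x => ‖G x‖ ^ r := (contDiff_norm_rpow (by linarith)).comp hG
  have hr0 : r ≠ 0 := by linarith
  have hpow : Continuous fun x => ‖G x‖ ^ (r - 2) :=
    hG.continuous.norm.rpow_const fun _ => Or.inr (by linarith)
  have hv' : Continuous (fderiv ℝ v) := hv.continuous_fderiv one_ne_zero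
  have hdiv_cont : Continuous (div3 v) :=
    ((LinearMap.trace ℝ (EuclideanSpace ℝ (Fin 3))) ∘ₗ
      ContinuousLinearMap.coeLM ℝ).continuous_of_finiteDimensional.comp hv'
  have hdiv_supp : HasCompactSupport (div3 v) :=
    (hv_supp.fderiv ℝ).comp_left
      (g := (LinearMap.trace ℝ (EuclideanSpace ℝ (Fin 3))) ∘ₗ ContinuousLinearMap.coeLM ℝ)
      (map_zero _)
  have hA : Integrable fun x => ‖G x‖ ^ (r - 2) * ⟪G x, fderiv ℝ v x (G x)⟫ := by
    refine (hpow.mul (hG.continuous.inner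
      (hv'.clm_apply hG.continuous))).integrable_of_hasCompactSupport ?_
    refine (hv_supp.fderiv ℝ).mono fun x hx => ?_
    contrapose! hx
    simp [Function.notMem_support.mp hx]
  have hB : Integrable fun x => fderiv ℝ (fun x => ‖G x‖ ^ r) x (v x) := by
    refine ((hh.continuous_fderiv one_ne_zero).clm_apply
      hv.continuous).integrable_of_hasCompactSupport (hv_supp.mono fun x hx => ?_)
    contrapose! hx
    simp [Function.notMem_support.mp hx]
  have hD : Integrable fun x => div3 v x * ‖G x‖ ^ r :=
    (hdiv_cont.mul hh.continuous).integrable_of_hasCompactSupport hdiv_supp.mul_right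
  have hpt (x) : ⟪gradient (fun y => ⟪v y, G y⟫) x, ‖G x‖ ^ (r - 2) • G x⟫ =
      ‖G x‖ ^ (r - 2) * ⟪G x, fderiv ℝ v x (G x)⟫ +
        (1 / r) * fderiv ℝ (fun x => ‖G x‖ ^ r) x (v x) := by
    rw [inner_smul_right, inner_gradient_left,
      fderiv_inner_apply ℝ (hv.differentiable one_ne_zero x) (hG.differentiable one_ne_zero x),
      (hG.differentiable one_ne_zero).fderiv_norm_rpow (by linarith),
      ← inner_fderiv_gradient_comm hρ, ← hG_def, real_inner_comm (G x) (fderiv ℝ v x (G x))]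
    simp only [smul_apply, ContinuousLinearMap.comp_apply,
      innerSL_apply_apply, smul_eq_mul, real_inner_comm (G x) (fderiv ℝ G x (v x))]
    field_simp
    ring
  simp_rw [hpt, mul_assoc (1 / r)]
  rw [integral_add hA (hB.const_mul _), integral_sub hA (hD.const_mul _), integral_const_mul,
    integral_const_mul, integral_fderiv_apply_eq_neg_integral_trace_mul hh hv hv_supp]
  ring
end
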